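/- arXiv:2105.06686 — 2 statements merged into one kernel-verified Lean document; each statement's English description precedes it below -/
import Mathlib

section
/- Size of the multi-dimensional expanded automaton: let A = (L, ℓ_init, C, Σ, I, E) be a TA, p : L → {0,…,d−1}^k a k-dimensional priority function and λ ∈ (ℕ∖{0})^k, and let A(p,λ) = (L', ℓ'_init, C', Σ', I', E') be the multi-dimensional expanded TA. Then |L'| = |L| · (d^k + 1), |C'| = |C| + k, |Σ'| = |Σ| + 2, and |E'| ≤ |E| · d^k + 2k · |L| · d^k + 2 · |L|. -/
open scoped NNReal

namespace TWPaper

variable {L C Act : Type}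

/-- Comparison operators appearing in clock constraints. -/
inductive Cmp where
  | le | ge | lt | gt

/-- An atomic clock constraint `x ∼ c` with `c : ℕ`. -/
structure Atom (C : Type) where
  clock : C
  cmp : Cmp
  bound : ℕ

/-- Clock valuations. -/
abbrev Val (C : Type) := C → ℝ≥0

def Atom.sat (ν : Val C) (a : Atom C) : Prop :=
  match a.cmp with
  | Cmp.le => ν a.clock ≤ (a.bound : ℝ≥0)
  | Cmp.ge => (a.bound : ℝ≥0) ≤ ν a.clock
  | Cmp.lt => ν a.clock < (a.bound : ℝ≥0)
  | Cmp.gt => (a.bound : ℝ≥0) < ν a.clock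

/-- A clock constraint: a finite conjunction of atomic constraints. -/
abbrev ClockConstraint (C : Type) := List (Atom C)

def satCC (ν : Val C) (g : ClockConstraint C) : Prop := ∀ a ∈ g, a.sat ν

/-- Let `d` time units pass. -/
def shift (ν : Val C) (d : ℝ≥0) : Val C := fun x => ν x + d

open Classical in
/-- Reset the clocks in `D` to `0`. -/
noncomputable def resetV (D : Set C) (ν : Val C) : Val C :=
  fun x => if x ∈ D then 0 else ν x

structure Edge (L C Act : Type) where
  src : L
  guard : ClockConstraint C
  act : Act
  resets : Set C
  tgt : L

/-- A timed automaton. -/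
structure TA (L C Act : Type) where
  init : L
  gamma : C
  inv : L → ClockConstraint C
  edges : Set (Edge L C Act)

/-- Well-formedness of a timed automaton: the special global clock `γ` is never
reset, and no two edges from the same location sharing an action have
simultaneously satisfiable guards (determinism). -/
def TA.WellFormed (A : TA L C Act) : Prop :=
  (∀ e ∈ A.edges, A.gamma ∉ e.resets) ∧
  (∀ e₁ ∈ A.edges, ∀ e₂ ∈ A.edges, e₁.src = e₂.src → e₁.act = e₂.act →
    (∃ ν : Val C, satCC ν e₁.guard ∧ satCC ν e₂.guard) → e₁ = e₂)

/-- A move: a delay together with an action (`none` is the special delay action `⊥`). -/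
abbrev Mv (Act : Type) := ℝ≥0 × Option Act

/-- The transition relation of the transition system of a timed automaton. -/
def TA.Trans (A : TA L C Act) (s : L × Val C) (m : Mv Act) (s' : L × Val C) : Prop :=
  satCC (shift s.2 m.1) (A.inv s.1) ∧
  (match m.2 with
   | none => s'.1 = s.1 ∧ s'.2 = shift s.2 m.1
   | some a => ∃ e ∈ A.edges, e.src = s.1 ∧ e.act = a ∧
       satCC (shift s.2 m.1) e.guard ∧ s'.1 = e.tgt ∧
       s'.2 = resetV e.resets (shift s.2 m.1) ∧ satCC s'.2 (A.inv e.tgt))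

/-- An infinite path of a timed automaton (the underlying data). -/
structure RawPath (L C Act : Type) where
  s : ℕ → L × Val C
  m : ℕ → Mv Act

def TA.IsPath (A : TA L C Act) (π : RawPath L C Act) : Prop :=
  ∀ n, A.Trans (π.s n) (π.m n) (π.s (n + 1))

/-- A timed game: a timed automaton together with a partition of the actions;
`isP1 a` means that `a` is a player-1 action (its complement is player 2's set). -/
structure TG (L C Act : Type) where
  ta : TA L C Act
  isP1 : Act → Prop

/-- Moves available to player 1 in state `s`. -/
def TG.Move1 (G : TG L C Act) (s : L × Val C) (m : Mv Act) : Prop :=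
  (∀ a, m.2 = some a → G.isP1 a) ∧ ∃ s', G.ta.Trans s m s'

/-- Moves available to player 2 in state `s`. -/
def TG.Move2 (G : TG L C Act) (s : L × Val C) (m : Mv Act) : Prop :=
  (∀ a, m.2 = some a → ¬ G.isP1 a) ∧ ∃ s', G.ta.Trans s m s'

/-- An infinite play of a timed game (the underlying data). -/
structure RawPlay (L C Act : Type) where
  s : ℕ → L × Val C
  m1 : ℕ → Mv Act
  m2 : ℕ → Mv Act

/-- The delay at step `n`: the minimum of the delays of the two chosen moves. -/
def RawPlay.delay (π : RawPlay L C Act) (n : ℕ) : ℝ≥0 := min (π.m1 n).1 (π.m2 n).1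

/-- The play obtained by removing the first `n` steps. -/
def RawPlay.drop (π : RawPlay L C Act) (n : ℕ) : RawPlay L C Act :=
  ⟨fun k => π.s (n + k), fun k => π.m1 (n + k), fun k => π.m2 (n + k)⟩

/-- The joint destination relation: the fastest move is carried out,
nondeterministically so in case of a tie. -/
def TG.JointDest (G : TG L C Act) (s : L × Val C) (m₁ m₂ : Mv Act) (s' : L × Val C) : Prop :=
  (m₁.1 < m₂.1 ∧ G.ta.Trans s m₁ s') ∨ (m₂.1 < m₁.1 ∧ G.ta.Trans s m₂ s') ∨
  (m₁.1 = m₂.1 ∧ (G.ta.Trans s m₁ s' ∨ G.ta.Trans s m₂ s'))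

def TG.StepOK (G : TG L C Act) (π : RawPlay L C Act) (n : ℕ) : Prop :=
  G.Move1 (π.s n) (π.m1 n) ∧ G.Move2 (π.s n) (π.m2 n) ∧
  G.JointDest (π.s n) (π.m1 n) (π.m2 n) (π.s (n + 1))

def TG.IsPlay (G : TG L C Act) (π : RawPlay L C Act) : Prop := ∀ n, G.StepOK π n

/-- `π` is a valid play for its first `n` steps (i.e., viewed as a finite play
consisting of `n` moves). -/
def TG.IsPlayUpTo (G : TG L C Act) (π : RawPlay L C Act) (n : ℕ) : Prop :=
  ∀ k < n, G.StepOK π k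

/-- The state/delay sequence of a play or path.  All the objectives considered
are state-based and are therefore defined on traces. -/
structure Trace (L C : Type) where
  st : ℕ → L × Val C
  dl : ℕ → ℝ≥0

def RawPlay.trace (π : RawPlay L C Act) : Trace L C := ⟨π.s, fun n => π.delay n⟩
def RawPath.trace (π : RawPath L C Act) : Trace L C := ⟨π.s, fun n => (π.m n).1⟩

/-- The delayed suffix `π_{n→}^{+d}`. -/
noncomputable def Trace.delayedSuffix (τ : Trace L C) (n : ℕ) (d : ℝ≥0) : Trace L C where
  st := fun k => if k = 0 then ((τ.st n).1, shift (τ.st n).2 d) else τ.st (n + k)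
  dl := fun k => if k = 0 then τ.dl n - d else τ.dl (n + k)

/-- The suffix `π_{n→} = π_{n→}^{+0}`. -/
noncomputable def Trace.suffix (τ : Trace L C) (n : ℕ) : Trace L C := τ.delayedSuffix n 0

/-- `min_{a ≤ k ≤ b} p(ℓ_k)`. -/
noncomputable def minPrioIcc (p : L → ℕ) (τ : Trace L C) (a b : ℕ) : ℕ :=
  sInf ((fun k => p (τ.st k).1) '' Set.Icc a b)

/-- The timed good window objective `TGW(p, λ)`. -/
def TGW (γ : C) (p : L → ℕ) (lam : ℕ) : Set (Trace L C) :=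
  {τ | ∃ j : ℕ, Even (minPrioIcc p τ 0 j) ∧ (τ.st j).2 γ - (τ.st 0).2 γ < (lam : ℝ≥0)}

/-- The direct timed window parity objective `DTW(p, λ)`. -/
def DTW (γ : C) (p : L → ℕ) (lam : ℕ) : Set (Trace L C) :=
  {τ | ∀ n : ℕ, ∀ d : ℝ≥0, d ≤ τ.dl n → τ.delayedSuffix n d ∈ TGW γ p lam}

/-- The timed window parity objective `TW(p, λ)`. -/
def TW (γ : C) (p : L → ℕ) (lam : ℕ) : Set (Trace L C) :=
  {τ | ∃ n : ℕ, τ.suffix n ∈ DTW γ p lam}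

/-- Time divergence: the global clock `γ` is unbounded along the trace. -/
def TimeDiv (γ : C) (τ : Trace L C) : Prop := ∀ B : ℝ≥0, ∃ j, B < (τ.st j).2 γ

/-- The parity objective: the least priority seen infinitely often is even. -/
def ParityObj (p : L → ℕ) : Set (Trace L C) :=
  {τ | Even (Filter.liminf (fun n => p (τ.st n).1) Filter.atTop)}

/-- The safety objective for the set `F` of locations. -/
def SafeObj (F : Set L) : Set (Trace L C) := {τ | ∀ n, (τ.st n).1 ∉ F}

/-- The co-Büchi objective for the set `F` of locations. -/
def CoBuchiObj (F : Set L) : Set (Trace L C) := {τ | ∃ N, ∀ n ≥ N, (τ.st n).1 ∉ F}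

/-! ### The expanded timed automaton (one dimension) -/

/-- Locations of the expanded automaton: `(ℓ, some q)` carries the priority `q`
of the current window, `(ℓ, none)` is the bad location `(ℓ, bad)`. -/
abbrev ExpLoc (L : Type) := L × Option ℕ
/-- Clocks of the expanded automaton: `none` is the fresh clock `z`. -/
abbrev ExpClock (C : Type) := Option C
/-- Actions of the expanded automaton: `Sum.inr true = β₁` and `Sum.inr false = β₂`. -/
abbrev ExpAct (Act : Type) := Act ⊕ Bool

def liftAtom {C C' : Type} (f : C → C') (a : Atom C) : Atom C' := ⟨f a.clock, a.cmp, a.bound⟩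

def liftCC {C C' : Type} (f : C → C') (g : ClockConstraint C) : ClockConstraint C' :=
  g.map (liftAtom f)

/-- The expanded timed automaton `A(p, λ)`, where the priorities used range over
`{0, …, d-1}`. -/
def expTA (A : TA L C Act) (d : ℕ) (p : L → ℕ) (lam : ℕ) :
    TA (ExpLoc L) (ExpClock C) (ExpAct Act) where
  init := (A.init, some (p A.init))
  gamma := some A.gamma
  inv := fun lq =>
    match lq.2 with
    | some q => liftCC some (A.inv lq.1) ++
        (if q % 2 = 1 then [⟨none, Cmp.le, lam⟩] else [])
    | none => [⟨none, Cmp.le, 0⟩, ⟨none, Cmp.ge, 0⟩]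
  edges :=
    {e : Edge (ExpLoc L) (ExpClock C) (ExpAct Act) |
      ∃ q < d, q % 2 = 0 ∧ ∃ e₀ ∈ A.edges,
        e = ⟨(e₀.src, some q), liftCC some e₀.guard, Sum.inl e₀.act,
             (Option.some '' e₀.resets) ∪ {none}, (e₀.tgt, some (p e₀.tgt))⟩} ∪
    {e : Edge (ExpLoc L) (ExpClock C) (ExpAct Act) |
      ∃ q < d, q % 2 = 1 ∧ ∃ e₀ ∈ A.edges,
        e = ⟨(e₀.src, some q), liftCC some e₀.guard ++ [⟨none, Cmp.lt, lam⟩],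
             Sum.inl e₀.act, Option.some '' e₀.resets,
             (e₀.tgt, some (min q (p e₀.tgt)))⟩} ∪
    {e : Edge (ExpLoc L) (ExpClock C) (ExpAct Act) |
      ∃ q < d, q % 2 = 1 ∧ ∃ (ℓ : L) (b : Bool),
        e = ⟨(ℓ, some q), [⟨none, Cmp.le, lam⟩, ⟨none, Cmp.ge, lam⟩], Sum.inr b,
             {none}, (ℓ, none)⟩} ∪
    {e : Edge (ExpLoc L) (ExpClock C) (ExpAct Act) |
      ∃ (ℓ : L) (b : Bool), e = ⟨(ℓ, none), [], Sum.inr b, ∅, (ℓ, some (p ℓ))⟩}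

/-- The expanded timed game `G(p, λ)`: `β₁` belongs to player 1, `β₂` to player 2. -/
def expTG (G : TG L C Act) (d : ℕ) (p : L → ℕ) (lam : ℕ) :
    TG (ExpLoc L) (ExpClock C) (ExpAct Act) :=
  ⟨expTA G.ta d p lam,
   fun a => match a with | Sum.inl a => G.isP1 a | Sum.inr b => b = true⟩

/-- The set `Bad = L × {bad}` of bad locations. -/
def BadLocs (L : Type) : Set (ExpLoc L) := {lq | lq.2 = none}

/-! ### The projection mapping -/

def projMove (m : Mv (ExpAct Act)) : Mv Act :=
  (m.1, match m.2 with
        | some (Sum.inl a) => some a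
        | some (Sum.inr _) => none
        | none => none)

def projState (s : ExpLoc L × Val (ExpClock C)) : L × Val C :=
  (s.1.1, fun c => s.2 (some c))

/-- The projection mapping `Pr`. -/
def projPlay (π : RawPlay (ExpLoc L) (ExpClock C) (ExpAct Act)) : RawPlay L C Act :=
  ⟨fun n => projState (π.s n), fun n => projMove (π.m1 n), fun n => projMove (π.m2 n)⟩

/-- A play of the expanded game is well-initialized if `q₀ = p(ℓ₀)` and `ν₀(z) = 0`. -/
def WellInit (p : L → ℕ) (π : RawPlay (ExpLoc L) (ExpClock C) (ExpAct Act)) : Prop :=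
  (π.s 0).1.2 = some (p (π.s 0).1.1) ∧ (π.s 0).2 none = 0

/-! ### The expansion mapping -/

def liftMove (m : Mv Act) : Mv (ExpAct Act) := (m.1, m.2.map Sum.inl)

def betaMv {Act : Type} (b : Bool) (t : ℝ≥0) : Mv (ExpAct Act) := (t, some (Sum.inr b))

/-- The conditions relating step `n` of a play `π` of `G` to the segment
`[f n, f (n+1)]` of its expansion `π'`, following the inductive definition of
the expansion mapping `Ex`. -/
def ExStep (p : L → ℕ) (lam : ℕ) (π : RawPlay L C Act)
    (π' : RawPlay (ExpLoc L) (ExpClock C) (ExpAct Act)) (f : ℕ → ℕ) (n : ℕ) : Prop :=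
  ∃ q : ℕ, (π'.s (f n)).1.2 = some q ∧
    (∀ z dn : ℝ≥0, z = (π'.s (f n)).2 none → dn = π.delay n →
      -- Cases 1 and 2.a : no bad window is detected during this step
      ((q % 2 = 0 ∨ z + dn < (lam : ℝ≥0)) →
        f (n + 1) = f n + 1 ∧
        (q % 2 = 0 →
          π'.m1 (f n) = liftMove (π.m1 n) ∧ π'.m2 (f n) = liftMove (π.m2 n)) ∧
        (q % 2 = 1 →
          ((z + (π.m1 n).1 < (lam : ℝ≥0) → π'.m1 (f n) = liftMove (π.m1 n)) ∧
           ((lam : ℝ≥0) ≤ z + (π.m1 n).1 →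
              π'.m1 (f n) = betaMv true ((lam : ℝ≥0) - z)) ∧
           (z + (π.m2 n).1 < (lam : ℝ≥0) → π'.m2 (f n) = liftMove (π.m2 n)) ∧
           ((lam : ℝ≥0) ≤ z + (π.m2 n).1 →
              π'.m2 (f n) = betaMv false ((lam : ℝ≥0) - z))))) ∧
      -- Case 2.b : a bad window is detected during this step; the expansion
      -- visits the bad location `μ` times
      (q % 2 = 1 → (lam : ℝ≥0) ≤ z + dn →
        ∃ μ : ℕ, 1 ≤ μ ∧
          (p (π.s n).1 % 2 = 0 → μ = 1) ∧
          (p (π.s n).1 % 2 = 1 →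
            ((μ * lam : ℕ) : ℝ≥0) ≤ z + dn ∧ z + dn < (((μ + 1) * lam : ℕ) : ℝ≥0)) ∧
          f (n + 1) = f n + 2 * μ + 1 ∧
          (∀ k < μ, (π'.s (f n + 2 * k + 1)).1 = ((π.s n).1, none)) ∧
          (∀ k, 1 ≤ k → k ≤ μ →
            (π'.s (f n + 2 * k)).1 = ((π.s n).1, some (p (π.s n).1))) ∧
          π'.m1 (f n) = betaMv true ((lam : ℝ≥0) - z) ∧
          π'.m2 (f n) = betaMv false ((lam : ℝ≥0) - z) ∧
          (∀ k < μ, π'.m1 (f n + 2 * k + 1) = betaMv true 0 ∧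
                    π'.m2 (f n + 2 * k + 1) = betaMv false 0) ∧
          (∀ k, 1 ≤ k → k < μ →
            π'.m1 (f n + 2 * k) = betaMv true (lam : ℝ≥0) ∧
            π'.m2 (f n + 2 * k) = betaMv false (lam : ℝ≥0)) ∧
          (∀ t' : ℝ≥0, t' = ((lam : ℝ≥0) - z) + ((μ - 1 : ℕ) : ℝ≥0) * (lam : ℝ≥0) →
            (((π.m1 n).1 - t' < (lam : ℝ≥0) ∨ p (π.s n).1 % 2 = 0) →
              π'.m1 (f n + 2 * μ) = ((π.m1 n).1 - t', (π.m1 n).2.map Sum.inl)) ∧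
            (¬ ((π.m1 n).1 - t' < (lam : ℝ≥0) ∨ p (π.s n).1 % 2 = 0) →
              π'.m1 (f n + 2 * μ) = betaMv true (lam : ℝ≥0)) ∧
            (((π.m2 n).1 - t' < (lam : ℝ≥0) ∨ p (π.s n).1 % 2 = 0) →
              π'.m2 (f n + 2 * μ) = ((π.m2 n).1 - t', (π.m2 n).2.map Sum.inl)) ∧
            (¬ ((π.m2 n).1 - t' < (lam : ℝ≥0) ∨ p (π.s n).1 % 2 = 0) →
              π'.m2 (f n + 2 * μ) = betaMv false (lam : ℝ≥0)))))

/-- `π'` is the expansion `Ex(π)` of the play `π`, presented relationally: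
`π'` is a play of the expanded game `G(p, λ)`, and there is an alignment
function `f` matching each step of `π` with the corresponding segment of `π'`
according to the inductive definition of the expansion mapping. -/
def IsExpansion (G : TG L C Act) (d : ℕ) (p : L → ℕ) (lam : ℕ)
    (π : RawPlay L C Act) (π' : RawPlay (ExpLoc L) (ExpClock C) (ExpAct Act)) : Prop :=
  (expTG G d p lam).IsPlay π' ∧
  ∃ f : ℕ → ℕ, f 0 = 0 ∧ StrictMono f ∧
    (π'.s 0).1.2 = some (p (π.s 0).1) ∧ (π'.s 0).2 none = 0 ∧
    (∀ n, (π'.s (f n)).1.1 = (π.s n).1 ∧ (π'.s (f n)).1.2 ≠ none ∧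
          (∀ c : C, (π'.s (f n)).2 (some c) = (π.s n).2 c)) ∧
    (∀ n, ExStep p lam π π' f n)

/-- The finite-play version of `IsExpansion`: the first `N` steps of `π'` form
the expansion of the finite play consisting of the first `n` steps of `π`. -/
def IsExpansionUpTo (G : TG L C Act) (d : ℕ) (p : L → ℕ) (lam : ℕ)
    (π : RawPlay L C Act) (π' : RawPlay (ExpLoc L) (ExpClock C) (ExpAct Act))
    (n N : ℕ) : Prop :=
  (expTG G d p lam).IsPlayUpTo π' N ∧
  ∃ f : ℕ → ℕ, f 0 = 0 ∧ StrictMono f ∧ f n = N ∧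
    (π'.s 0).1.2 = some (p (π.s 0).1) ∧ (π'.s 0).2 none = 0 ∧
    (∀ k ≤ n, (π'.s (f k)).1.1 = (π.s k).1 ∧ (π'.s (f k)).1.2 ≠ none ∧
          (∀ c : C, (π'.s (f k)).2 (some c) = (π.s k).2 c)) ∧
    (∀ k < n, ExStep p lam π π' f k)

/-! ### Strategies -/

/-- A strategy: given the length `n` of the history and a play (of which only
the first `n` steps are meaningful), produce a move. -/
abbrev Strategy (L C Act : Type) := ℕ → RawPlay L C Act → Mv Act

/-- A strategy depends only on the (relevant prefix of the) history. -/
def PrefixDep (σ : Strategy L C Act) : Prop :=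
  ∀ n (π π' : RawPlay L C Act), (∀ k ≤ n, π.s k = π'.s k) →
    (∀ k < n, π.m1 k = π'.m1 k ∧ π.m2 k = π'.m2 k) → σ n π = σ n π'

/-- A move-independent strategy: it depends only on the sequence of states. -/
def MoveIndep (σ : Strategy L C Act) : Prop :=
  ∀ n (π π' : RawPlay L C Act), (∀ k ≤ n, π.s k = π'.s k) → σ n π = σ n π'

/-- `σ` is a valid player-1 strategy in `G`. -/
def IsStrategy1 (G : TG L C Act) (σ : Strategy L C Act) : Prop :=
  PrefixDep σ ∧ ∀ n π, G.IsPlayUpTo π n → G.Move1 (π.s n) (σ n π)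

/-- The play `π` is consistent with the player-1 strategy `σ`. -/
def Consistent1 (σ : Strategy L C Act) (π : RawPlay L C Act) : Prop :=
  ∀ n, π.m1 n = σ n π

/-- Player 1 is not responsible for the transition at step `n` of `π`. -/
def NotResp1 (G : TG L C Act) (π : RawPlay L C Act) (n : ℕ) : Prop :=
  (π.m2 n).1 < (π.m1 n).1 ∨
  ((π.m1 n).1 = (π.m2 n).1 ∧ ¬ G.ta.Trans (π.s n) (π.m1 n) (π.s (n + 1)))

/-- A play is `P₁`-blameless if from some step on, player 1 is never
responsible for the transition. -/
def Blameless1 (G : TG L C Act) (π : RawPlay L C Act) : Prop :=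
  ∃ N, ∀ n ≥ N, NotResp1 G π n

/-- `σ` is a winning player-1 strategy from `s0` for the objective `Ψ`:
every consistent play from `s0` is either time-divergent and in `Ψ`, or
time-convergent and `P₁`-blameless. -/
def Winning1 (G : TG L C Act) (σ : Strategy L C Act) (Ψ : Set (Trace L C))
    (s0 : L × Val C) : Prop :=
  IsStrategy1 G σ ∧ ∀ π : RawPlay L C Act, G.IsPlay π → π.s 0 = s0 → Consistent1 σ π →
    (TimeDiv G.ta.gamma π.trace ∧ π.trace ∈ Ψ) ∨
    (¬ TimeDiv G.ta.gamma π.trace ∧ Blameless1 G π)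

/-! ### The multi-dimensional expanded automaton -/

/-- Locations of the multi-dimensional expanded automaton. -/
abbrev MExpLoc (L : Type) (k : ℕ) := L × Option (Fin k → ℕ)
/-- Clocks of the multi-dimensional expanded automaton: `Sum.inr i` is `z_i`. -/
abbrev MExpClock (C : Type) (k : ℕ) := C ⊕ Fin k

/-- The update function for vectors of priorities. -/
def mUp {k : ℕ} (q : Fin k → ℕ) (p : L → Fin k → ℕ) (ℓ : L) : Fin k → ℕ :=
  fun i => if q i % 2 = 1 then min (q i) (p ℓ i) else p ℓ i

/-- The multi-dimensional expanded timed automaton `A(p, λ)` for a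
`k`-dimensional priority function with priorities in `{0, …, d-1}`. -/
def mExpTA (A : TA L C Act) (k d : ℕ) (hk : 0 < k) (p : L → Fin k → ℕ)
    (lam : Fin k → ℕ) : TA (MExpLoc L k) (MExpClock C k) (ExpAct Act) where
  init := (A.init, some (p A.init))
  gamma := Sum.inl A.gamma
  inv := fun lq =>
    match lq.2 with
    | some q => liftCC Sum.inl (A.inv lq.1) ++
        ((List.finRange k).filter (fun i => decide (q i % 2 = 1))).map
          (fun i => ⟨Sum.inr i, Cmp.le, lam i⟩)
    | none => [⟨Sum.inr ⟨0, hk⟩, Cmp.le, 0⟩, ⟨Sum.inr ⟨0, hk⟩, Cmp.ge, 0⟩]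
  edges :=
    {e : Edge (MExpLoc L k) (MExpClock C k) (ExpAct Act) |
      ∃ q : Fin k → ℕ, (∀ i, q i < d) ∧ ∃ e₀ ∈ A.edges,
        e = ⟨(e₀.src, some q),
             liftCC Sum.inl e₀.guard ++
               ((List.finRange k).filter (fun i => decide (q i % 2 = 1))).map
                 (fun i => ⟨Sum.inr i, Cmp.lt, lam i⟩),
             Sum.inl e₀.act,
             (Sum.inl '' e₀.resets) ∪ (Sum.inr '' {i : Fin k | ¬ q i % 2 = 1}),
             (e₀.tgt, some (mUp q p e₀.tgt))⟩} ∪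
    {e : Edge (MExpLoc L k) (MExpClock C k) (ExpAct Act) |
      ∃ q : Fin k → ℕ, (∀ i, q i < d) ∧ ∃ (ℓ : L) (i : Fin k) (b : Bool), q i % 2 = 1 ∧
        e = ⟨(ℓ, some q),
             [⟨Sum.inr i, Cmp.le, lam i⟩, ⟨Sum.inr i, Cmp.ge, lam i⟩] ++
               ((List.finRange k).filter (fun j => decide (j < i ∧ q j % 2 = 1))).map
                 (fun j => ⟨Sum.inr j, Cmp.lt, lam j⟩),
             Sum.inr b, Sum.inr '' (Set.univ : Set (Fin k)), (ℓ, none)⟩} ∪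
    {e : Edge (MExpLoc L k) (MExpClock C k) (ExpAct Act) |
      ∃ (ℓ : L) (b : Bool), e = ⟨(ℓ, none), [], Sum.inr b, ∅, (ℓ, some (p ℓ))⟩}

/-- The multi-dimensional expanded timed game `G(p, λ)`. -/
def mExpTG (G : TG L C Act) (k d : ℕ) (hk : 0 < k) (p : L → Fin k → ℕ)
    (lam : Fin k → ℕ) : TG (MExpLoc L k) (MExpClock C k) (ExpAct Act) :=
  ⟨mExpTA G.ta k d hk p lam,
   fun a => match a with | Sum.inl a => G.isP1 a | Sum.inr b => b = true⟩

/-- The set of bad locations of the multi-dimensional expanded automaton. -/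
def MBadLocs (L : Type) (k : ℕ) : Set (MExpLoc L k) := {lq | lq.2 = none}

/-- The generalized timed window objective `GTW(p, λ)`. -/
def GTW (γ : C) {k : ℕ} (p : L → Fin k → ℕ) (lam : Fin k → ℕ) : Set (Trace L C) :=
  {τ | ∀ i : Fin k, τ ∈ TW γ (fun ℓ => p ℓ i) (lam i)}

/-- The generalized direct timed window objective `GDTW(p, λ)`. -/
def GDTW (γ : C) {k : ℕ} (p : L → Fin k → ℕ) (lam : Fin k → ℕ) : Set (Trace L C) :=
  {τ | ∀ i : Fin k, τ ∈ DTW γ (fun ℓ => p ℓ i) (lam i)}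

end TWPaper
namespace TWPaper

/-- The copy of the edge `e` of the original automaton that leaves priority vector `q`. -/
def stepEdge {L C Act : Type} {k : ℕ} (p : L → Fin k → ℕ) (lam : Fin k → ℕ)
    (e : Edge L C Act) (q : Fin k → ℕ) : Edge (MExpLoc L k) (MExpClock C k) (ExpAct Act) :=
  ⟨(e.src, some q),
    liftCC Sum.inl e.guard ++
      ((List.finRange k).filter (fun i => decide (q i % 2 = 1))).map
        (fun i => ⟨Sum.inr i, Cmp.lt, lam i⟩),
    Sum.inl e.act,
    (Sum.inl '' e.resets) ∪ (Sum.inr '' {i : Fin k | ¬ q i % 2 = 1}),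
    (e.tgt, some (mUp q p e.tgt))⟩

/-- The edge to the bad copy of `ℓ` taken when the window of dimension `i` expires. -/
def detectEdge {L C Act : Type} {k : ℕ} (lam : Fin k → ℕ) (q : Fin k → ℕ) (ℓ : L)
    (i : Fin k) (b : Bool) : Edge (MExpLoc L k) (MExpClock C k) (ExpAct Act) :=
  ⟨(ℓ, some q),
    [⟨Sum.inr i, Cmp.le, lam i⟩, ⟨Sum.inr i, Cmp.ge, lam i⟩] ++
      ((List.finRange k).filter (fun j => decide (j < i ∧ q j % 2 = 1))).map
        (fun j => ⟨Sum.inr j, Cmp.lt, lam j⟩),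
    Sum.inr b, Sum.inr '' (Set.univ : Set (Fin k)), (ℓ, none)⟩

/-- The edge leaving the bad copy of `ℓ`. -/
def exitEdge {L C Act : Type} {k : ℕ} (p : L → Fin k → ℕ) (ℓ : L) (b : Bool) :
    Edge (MExpLoc L k) (MExpClock C k) (ExpAct Act) :=
  ⟨(ℓ, none), [], Sum.inr b, ∅, (ℓ, some (p ℓ))⟩

theorem mExpTA_edges_subset {L C Act : Type} (A : TA L C Act) (k d : ℕ) (hk : 0 < k)
    (p : L → Fin k → ℕ) (lam : Fin k → ℕ) :
    (mExpTA A k d hk p lam).edges ⊆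
      Set.range (fun x : A.edges × (Fin k → Fin d) => stepEdge p lam x.1 (fun i => x.2 i)) ∪
      Set.range (fun x : (Fin k → Fin d) × L × Fin k × Bool =>
        detectEdge lam (fun i => x.1 i) x.2.1 x.2.2.1 x.2.2.2) ∪
      Set.range (fun x : L × Bool => exitEdge p x.1 x.2) := by
  rintro _ ((⟨q, hq, e, he, rfl⟩ | ⟨q, hq, ℓ, i, b, -, rfl⟩) | ⟨ℓ, b, rfl⟩)
  · exact Or.inl (Or.inl ⟨(⟨e, he⟩, fun i => ⟨q i, hq i⟩), rfl⟩)
  · exact Or.inl (Or.inr ⟨(fun i => ⟨q i, hq i⟩, ℓ, i, b), rfl⟩)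
  · exact Or.inr ⟨(ℓ, b), rfl⟩

theorem ncard_range_le {α β : Type*} [Finite α] (f : α → β) :
    (Set.range f).ncard ≤ Nat.card α := by
  rw [← Set.image_univ, ← Set.ncard_univ]
  exact Set.ncard_image_le

theorem card_expandedLocations {L : Type} [Finite L] {k d : ℕ} :
    Nat.card {lq : MExpLoc L k // lq.2 = none ∨ ∃ q, lq.2 = some q ∧ ∀ i, q i < d}
      = Nat.card L * (d ^ k + 1) := by
  let f : L × Option (Fin k → Fin d) → MExpLoc L k :=
    Prod.map id (Option.map fun q i => (q i : ℕ))
  have hf : Function.Injective f := Function.injective_id.prodMap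
    (Option.map_injective fun _ _ h => funext fun i => Fin.ext (congrFun h i))
  have hrange : {lq : MExpLoc L k | lq.2 = none ∨ ∃ q, lq.2 = some q ∧ ∀ i, q i < d}
      = Set.range f := by
    ext ⟨ℓ, o⟩
    constructor
    · rintro (h | ⟨q, h, hq⟩) <;> obtain rfl := h
      · exact ⟨(ℓ, none), rfl⟩
      · exact ⟨(ℓ, some fun i => ⟨q i, hq i⟩), rfl⟩
    · rintro ⟨⟨_, _ | q⟩, h⟩ <;> obtain ⟨rfl, rfl⟩ := Prod.mk.inj h
      · exact Or.inl rfl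
      · exact Or.inr ⟨_, rfl, fun i => (q i).isLt⟩
  calc _ = Nat.card (Set.range f) := by rw [← hrange]; rfl
    _ = Nat.card (L × Option (Fin k → Fin d)) := Nat.card_range_of_injective hf
    _ = _ := by simp

/-- size of the multi-dimensional expanded automaton.
For the expanded automaton `A(p,λ)` of a timed automaton `A` with priorities in
`{0,…,d-1}^k`: the number of locations (those of the form `(ℓ, bad)` or
`(ℓ, q)` with `q ∈ {0,…,d-1}^k`) is `|L|·(d^k + 1)`, the number of clocks is
`|C| + k`, the number of actions is `|Σ| + 2`, and the number of edges is at
most `|E|·d^k + 2k·|L|·d^k + 2·|L|`. -/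
theorem statement16 {L C Act : Type} [Fintype L] [Fintype C] [Fintype Act]
    (A : TA L C Act) (hwf : A.WellFormed) (hfin : A.edges.Finite)
    (k d : ℕ) (hk : 0 < k)
    (p : L → Fin k → ℕ) (hp : ∀ ℓ i, p ℓ i < d)
    (lam : Fin k → ℕ) (hlam : ∀ i, lam i ≠ 0) :
    Nat.card {lq : MExpLoc L k // lq.2 = none ∨ ∃ q, lq.2 = some q ∧ ∀ i, q i < d}
        = Nat.card L * (d ^ k + 1) ∧
    Nat.card (MExpClock C k) = Nat.card C + k ∧
    Nat.card (ExpAct Act) = Nat.card Act + 2 ∧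
    Nat.card ↥(mExpTA A k d hk p lam).edges
        ≤ Nat.card ↥A.edges * d ^ k + 2 * k * Nat.card L * d ^ k + 2 * Nat.card L := by
  refine ⟨card_expandedLocations, by simp, by simp, ?_⟩
  have := hfin.to_subtype
  have hsub := mExpTA_edges_subset A k d hk p lam
  have hstep := ncard_range_le fun x : A.edges × (Fin k → Fin d) =>
    stepEdge p lam x.1.1 (fun i => x.2 i)
  have hdetect := ncard_range_le fun x : (Fin k → Fin d) × L × Fin k × Bool =>
    detectEdge (C := C) (Act := Act) lam (fun i => x.1 i) x.2.1 x.2.2.1 x.2.2.2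
  have hexit := ncard_range_le fun x : L × Bool =>
    exitEdge (C := C) (Act := Act) p x.1 x.2
  rw [Nat.card_coe_set_eq]
  refine (Set.ncard_le_ncard hsub ((Set.finite_range _).union (Set.finite_range _) |>.union
    (Set.finite_range _))).trans ?_
  refine (Set.ncard_union_le _ _).trans ?_
  refine (Nat.add_le_add_right (Set.ncard_union_le _ _) _).trans ?_
  refine (Nat.add_le_add (Nat.add_le_add hstep hdetect) hexit).trans (le_of_eq ?_)
  simp only [Nat.card_prod, Nat.card_fun, Nat.card_fin, Nat.card_eq_fintype_card (α := Bool),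
    Fintype.card_bool]
  ring

end TWPaper
end

section
/- Safety reduces to timed window objectives: let A = (L, ℓ_init, C, Σ, I, E) be a TA and F ⊆ L a set of unsafe locations. Define the TA A' with locations L × {0,1}, initial location (ℓ_init, 0) if ℓ_init ∉ F and (ℓ_init, 1) otherwise, same clocks and actions, invariants I'((ℓ,b)) = I(ℓ), and edges: for each (ℓ,g,a,D,ℓ') ∈ E, the edges ((ℓ,0), g, a, D, (ℓ',0)) if ℓ' ∉ F, ((ℓ,0), g, a, D, (ℓ',1)) if ℓ' ∈ F, and ((ℓ,1), g, a, D, (ℓ',1)); and define the priority function p((ℓ,b)) = b. Then there exists a time-divergent initial path of A that violates Safe(F) if and only if there exists a time-divergent initial path of A' that violates TW(p,1), and likewise if and only if there exists a time-divergent initial path of A' that violates DTW(p,1). -/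
open scoped NNReal

namespace TWPaper

open Classical in
/-- The timed automaton `A'` obtained from `A` and a set `F` of unsafe
locations: locations are pairs `(ℓ, b)` where the Boolean `b` records whether
`F` has been visited; `b` is the priority of the location. -/
noncomputable def safetyExp {L C Act : Type} (A : TA L C Act) (F : Set L) :
    TA (L × Bool) C Act where
  init := (A.init, if A.init ∈ F then true else false)
  gamma := A.gamma
  inv := fun lb => A.inv lb.1
  edges :=
    {e : Edge (L × Bool) C Act | ∃ e₀ ∈ A.edges,
      (e₀.tgt ∉ F ∧ e = ⟨(e₀.src, false), e₀.guard, e₀.act, e₀.resets, (e₀.tgt, false)⟩) ∨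
      (e₀.tgt ∈ F ∧ e = ⟨(e₀.src, false), e₀.guard, e₀.act, e₀.resets, (e₀.tgt, true)⟩) ∨
      (e = ⟨(e₀.src, true), e₀.guard, e₀.act, e₀.resets, (e₀.tgt, true)⟩)}

/-- Transitions of `A` lift to the expansion, provided the Boolean component is updated
according to visits of `F`. -/
theorem safetyExp_trans_of_trans {L C Act : Type} {A : TA L C Act} {F : Set L}
    {s s' : L × Val C} {m : Mv Act} {b b' : Bool} (h : A.Trans s m s')
    (hb : b = false → s.1 ∉ F) (hb' : b' = true ↔ b = true ∨ s'.1 ∈ F) :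
    (safetyExp A F).Trans ((s.1, b), s.2) m ((s'.1, b'), s'.2) := by
  obtain ⟨d, _ | a⟩ := m
  · obtain ⟨hinv, hloc, hval⟩ := h
    refine ⟨hinv, ?_, hval⟩
    rw [hloc] at hb' ⊢
    cases b <;> cases b' <;> simp_all
  · obtain ⟨hinv, e, he, hsrc, hact, hguard, htgt, hval, hinv'⟩ := h
    refine ⟨hinv, ⟨(e.src, b), e.guard, e.act, e.resets, (e.tgt, b')⟩, ⟨e, he, ?_⟩, ?_,
      hact, hguard, ?_, hval, hinv'⟩
    · rw [htgt] at hb'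
      cases b <;> cases b' <;> simp_all
    · simp [hsrc]
    · simp [htgt]

/-- Transitions of the expansion project to `A`, and the Boolean component is only set to
`true` when `F` is entered. -/
theorem trans_of_safetyExp_trans {L C Act : Type} {A : TA L C Act} {F : Set L}
    {t t' : (L × Bool) × Val C} {m : Mv Act} (h : (safetyExp A F).Trans t m t') :
    A.Trans (t.1.1, t.2) m (t'.1.1, t'.2) ∧ (t'.1.2 = true → t.1.2 = true ∨ t'.1.1 ∈ F) := by
  obtain ⟨d, _ | a⟩ := m
  · obtain ⟨hinv, hloc, hval⟩ := h
    exact ⟨⟨hinv, congrArg (fun x => x.1) hloc, hval⟩, fun ht => Or.inl (hloc ▸ ht)⟩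
  · obtain ⟨hinv, e, ⟨e₀, he₀, hcases⟩, hsrc, hact, hguard, htgt, hval, hinv'⟩ := h
    rcases hcases with ⟨hF, rfl⟩ | ⟨hF, rfl⟩ | rfl <;>
      refine ⟨⟨hinv, e₀, he₀, congrArg Prod.fst hsrc, hact, hguard,
        congrArg Prod.fst htgt, hval, hinv'⟩, fun ht => ?_⟩
    · simp [htgt] at ht
    · exact Or.inr (by simpa [htgt] using hF)
    · exact Or.inl (by simp [← hsrc])

/-- A trace that only has even priorities belongs to the direct timed window objective. -/
theorem mem_DTW_of_forall_even {L C : Type} {γ : C} {p : L → ℕ} {lam : ℕ} (hlam : 0 < lam)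
    {τ : Trace L C} (h : ∀ n, Even (p (τ.st n).1)) : τ ∈ DTW γ p lam := by
  intro n d _
  refine ⟨0, ?_, ?_⟩
  · simpa [minPrioIcc, Trace.delayedSuffix] using h n
  · simpa using hlam

/-- The direct timed window objective is contained in the timed window objective. -/
theorem DTW_subset_TW {L C : Type} (γ : C) (p : L → ℕ) (lam : ℕ) :
    DTW γ p lam ⊆ TW γ p lam := by
  intro τ h
  refine ⟨0, ?_⟩
  have : τ.suffix 0 = τ := by
    obtain ⟨st, dl⟩ := τ
    have hshift : ∀ ν : Val C, shift ν 0 = ν := fun ν => funext fun x => add_zero (ν x)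
    simp only [Trace.suffix, Trace.delayedSuffix, hshift, Trace.mk.injEq]
    constructor <;> funext k <;> by_cases hk : k = 0 <;> simp [hk]
  rwa [this]

/-- A trace whose priorities are eventually constant and odd violates the timed window
objective. -/
theorem notMem_TW_of_eventually_odd {L C : Type} {γ : C} {p : L → ℕ} {lam : ℕ}
    {τ : Trace L C} {c N : ℕ} (hc : Odd c) (h : ∀ n ≥ N, p (τ.st n).1 = c) :
    τ ∉ TW γ p lam := by
  rintro ⟨n, hn⟩
  obtain ⟨j, hj, -⟩ := hn N 0 zero_le
  have hprio : ∀ k, p ((((τ.suffix n).delayedSuffix N 0).st k).1) = c := by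
    intro k
    have hk := h (n + (N + k)) (by lia)
    by_cases hk0 : k = 0 <;> by_cases hN : N = 0 <;>
      simp_all [Trace.suffix, Trace.delayedSuffix]
  have hmin : minPrioIcc p ((τ.suffix n).delayedSuffix N 0) 0 j = c := by
    simp only [minPrioIcc, hprio]
    rw [Set.Nonempty.image_const ⟨0, by simp⟩, csInf_singleton]
  rw [hmin] at hj
  exact Nat.not_even_iff_odd.mpr hc hj

/-- An initial time-divergent path of `A` violating safety yields one of the expansion
violating the timed window objective. -/
theorem exists_path_notMem_TW {L C Act : Type} {A : TA L C Act} {F : Set L}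
    {π : RawPath L C Act} (hπ : A.IsPath π) (h0 : π.s 0 = (A.init, fun _ => 0))
    (hdiv : TimeDiv A.gamma π.trace) (hF : π.trace ∉ SafeObj F) :
    ∃ π' : RawPath (L × Bool) C Act, (safetyExp A F).IsPath π' ∧
      π'.s 0 = ((safetyExp A F).init, fun _ => 0) ∧ TimeDiv A.gamma π'.trace ∧
      π'.trace ∉ TW (safetyExp A F).gamma (fun lb => cond lb.2 1 0) 1 := by
  classical
  let b : ℕ → Bool := fun n => decide (∃ k ≤ n, (π.s k).1 ∈ F)
  refine ⟨⟨fun n => (((π.s n).1, b n), (π.s n).2), π.m⟩, fun n => ?_, ?_, hdiv, ?_⟩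
  · refine safetyExp_trans_of_trans (hπ n) (fun hb => ?_) ?_
    · simp only [b, decide_eq_false_iff_not] at hb
      exact fun hn => hb ⟨n, le_rfl, hn⟩
    · simp only [b, decide_eq_true_eq, Nat.le_succ_iff, or_and_right, exists_or,
        exists_eq_left]
  · simp [b, h0, safetyExp]
  · simp only [SafeObj, Set.mem_ofPred_eq, not_forall, not_not] at hF
    obtain ⟨N, hN⟩ := hF
    refine notMem_TW_of_eventually_odd (c := 1) (N := N) odd_one fun n hn => ?_
    have hb : b n = true := decide_eq_true ⟨N, hn, hN⟩
    simp [RawPath.trace, hb]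

/-- An initial time-divergent path of the expansion violating the direct timed window
objective yields one of `A` violating safety. -/
theorem exists_path_notMem_SafeObj {L C Act : Type} {A : TA L C Act} {F : Set L}
    {π' : RawPath (L × Bool) C Act} (hπ' : (safetyExp A F).IsPath π')
    (h0 : π'.s 0 = ((safetyExp A F).init, fun _ => 0)) (hdiv : TimeDiv A.gamma π'.trace)
    (hD : π'.trace ∉ DTW (safetyExp A F).gamma (fun lb => cond lb.2 1 0) 1) :
    ∃ π : RawPath L C Act, A.IsPath π ∧ π.s 0 = (A.init, fun _ => 0) ∧
      TimeDiv A.gamma π.trace ∧ π.trace ∉ SafeObj F := by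
  refine ⟨⟨fun n => ((π'.s n).1.1, (π'.s n).2), π'.m⟩,
    fun n => (trans_of_safetyExp_trans (hπ' n)).1, ?_, hdiv, fun hsafe => hD ?_⟩
  · simp [h0, safetyExp]
  · have hb : ∀ n, (π'.s n).1.2 = false := by
      intro n
      induction n with
      | zero =>
        have hinit : A.init ∉ F := by simpa [RawPath.trace, h0, safetyExp] using hsafe 0
        simp [h0, safetyExp, hinit]
      | succ n ih =>
        by_contra hne
        rcases (trans_of_safetyExp_trans (hπ' n)).2 (by simpa using hne) with h | h
        · simp [ih] at h
        · exact hsafe (n + 1) h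
    exact mem_DTW_of_forall_even one_pos fun n => by simp [RawPath.trace, hb n]

/-- safety reduces to timed window objectives.
There is a time-divergent initial path of `A` violating `Safe(F)` iff there is
a time-divergent initial path of `A'` violating `TW(p, 1)`, and likewise iff
there is a time-divergent initial path of `A'` violating `DTW(p, 1)`, where
`p (ℓ, b) = b`. -/
theorem statement17 {L C Act : Type} [Finite L] [Finite C] [Finite Act]
    (A : TA L C Act) (hwf : A.WellFormed) (F : Set L) :
    ((∃ π : RawPath L C Act, A.IsPath π ∧ π.s 0 = (A.init, fun _ => 0) ∧
        TimeDiv A.gamma π.trace ∧ π.trace ∉ SafeObj F) ↔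
      (∃ π' : RawPath (L × Bool) C Act, (safetyExp A F).IsPath π' ∧
        π'.s 0 = ((safetyExp A F).init, fun _ => 0) ∧
        TimeDiv A.gamma π'.trace ∧
        π'.trace ∉ TW (safetyExp A F).gamma (fun lb => cond lb.2 1 0) 1)) ∧
    ((∃ π : RawPath L C Act, A.IsPath π ∧ π.s 0 = (A.init, fun _ => 0) ∧
        TimeDiv A.gamma π.trace ∧ π.trace ∉ SafeObj F) ↔
      (∃ π' : RawPath (L × Bool) C Act, (safetyExp A F).IsPath π' ∧
        π'.s 0 = ((safetyExp A F).init, fun _ => 0) ∧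
        TimeDiv A.gamma π'.trace ∧
        π'.trace ∉ DTW (safetyExp A F).gamma (fun lb => cond lb.2 1 0) 1)) := by
  constructor <;> constructor
  · rintro ⟨π, hπ, h0, hdiv, hF⟩
    exact exists_path_notMem_TW hπ h0 hdiv hF
  · rintro ⟨π', hπ', h0, hdiv, hT⟩
    exact exists_path_notMem_SafeObj hπ' h0 hdiv fun h => hT (DTW_subset_TW _ _ _ h)
  · rintro ⟨π, hπ, h0, hdiv, hF⟩
    obtain ⟨π', hπ', h0', hdiv', hT⟩ := exists_path_notMem_TW hπ h0 hdiv hF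
    exact ⟨π', hπ', h0', hdiv', fun h => hT (DTW_subset_TW _ _ _ h)⟩
  · rintro ⟨π', hπ', h0, hdiv, hD⟩
    exact exists_path_notMem_SafeObj hπ' h0 hdiv hD

end TWPaper
end
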